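/- arXiv:1911.01743 — 2 statements merged into one kernel-verified Lean document; each statement's English description precedes it below -/
import Mathlib

section
/- Let p be a prime, k ≥ 1 an integer, and n a positive integer with p ∤ n. Then Φ*_{p^k n}(x) = Φ*_n(x^{p^k}) / Φ*_n(x); equivalently, as an identity of polynomials, Φ*_{p^k n}(x) · Φ*_n(x) = Φ*_n(x^{p^k}). -/
open Polynomial Finset

/-- The finset of unitary divisors of `n`: divisors `d` of `n` with `gcd (d, n / d) = 1`. -/
def unitaryDivisors (n : ℕ) : Finset ℕ :=
  n.divisors.filter fun d => Nat.Coprime d (n / d)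

/-- `d ∣∣ n`: `d` is a unitary divisor of `n`. -/
def IsUnitaryDivisor (d n : ℕ) : Prop := d ∈ unitaryDivisors n

/-- `(j, n)_*`: the greatest `d` such that `d ∣ j` and `d` is a unitary divisor of `n`. -/
def unitaryGcd (j n : ℕ) : ℕ :=
  ((unitaryDivisors n).filter fun d => d ∣ j).sup id

/-- `κ(n)`: the squarefree kernel (radical) of `n`. -/
def kernel (n : ℕ) : ℕ := ∏ p ∈ n.primeFactors, p

/-- `φ*(n)`: the unitary Euler totient function. -/
def unitaryTotient (n : ℕ) : ℕ :=
  ((Finset.Icc 1 n).filter fun j => unitaryGcd j n = 1).card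

/-- `μ*(n) = (-1)^{ω(n)}`: the unitary Moebius function. -/
def unitaryMoebius (n : ℕ) : ℤ := (-1) ^ n.primeFactors.card

/-- `Φ*_n`: the unitary cyclotomic polynomial (over `ℂ`). -/
noncomputable def unitaryCyclotomic (n : ℕ) : Polynomial ℂ :=
  ∏ j ∈ (Finset.Icc 1 n).filter fun j => unitaryGcd j n = 1,
    (X - C (Complex.exp (2 * (Real.pi : ℂ) * Complex.I * (j : ℂ) / (n : ℂ))))

/-- `c*_n(k)`: the unitary Ramanujan sum. -/
noncomputable def unitaryRamanujan (n k : ℕ) : ℂ :=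
  ∑ j ∈ (Finset.Icc 1 n).filter fun j => unitaryGcd j n = 1,
    Complex.exp (2 * (Real.pi : ℂ) * Complex.I * (j : ℂ) * (k : ℂ) / (n : ℂ))

/-- `c_n(k)`: the classical Ramanujan sum. -/
noncomputable def ramanujanSum (n k : ℕ) : ℂ :=
  ∑ j ∈ (Finset.Icc 1 n).filter fun j => Nat.Coprime j n,
    Complex.exp (2 * (Real.pi : ℂ) * Complex.I * (j : ℂ) * (k : ℂ) / (n : ℂ))

/-- The unitary convolution `(f × g)(n) = ∑_{d ∣∣ n} f(d) g(n/d)`. -/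
noncomputable def unitaryConv (f g : ℕ → ℂ) (n : ℕ) : ℂ :=
  ∑ d ∈ unitaryDivisors n, f d * g (n / d)

/-- `Λ*(n)`: the unitary von Mangoldt function, `a log p` for `n = p^a`, else `0`. -/
noncomputable def unitaryVonMangoldt (n : ℕ) : ℝ :=
  if IsPrimePow n then (n.factorization n.minFac : ℝ) * Real.log n.minFac else 0

theorem unitaryGcd_eq_one_iff {n : ℕ} (hn : 0 < n) (j : ℕ) :
    unitaryGcd j n = 1 ↔ ∀ d, d ∣ n → Nat.Coprime d (n / d) → d ∣ j → d = 1 := by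
  have mem_iff (d : ℕ) : d ∈ (unitaryDivisors n).filter (· ∣ j) ↔
      d ∣ n ∧ Nat.Coprime d (n / d) ∧ d ∣ j := by
    simp [unitaryDivisors, hn.ne', and_assoc]
  unfold unitaryGcd
  constructor
  · intro h d hdn hd hdj
    have hle : id d ≤ _ := Finset.le_sup (f := id) ((mem_iff d).2 ⟨hdn, hd, hdj⟩)
    rw [h] at hle
    exact le_antisymm hle (Nat.pos_of_dvd_of_pos hdn hn)
  · intro h
    apply le_antisymm
    · refine Finset.sup_le fun d hd => ?_
      obtain ⟨hdn, hd, hdj⟩ := (mem_iff d).1 hd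
      exact (h d hdn hd hdj).le
    · exact Finset.le_sup (f := id) ((mem_iff 1).2 (by simp))

theorem unitaryGcd_add_mul_eq_one_iff {n : ℕ} (hn : 0 < n) (j t : ℕ) :
    unitaryGcd (j + n * t) n = 1 ↔ unitaryGcd j n = 1 := by
  rw [unitaryGcd_eq_one_iff hn, unitaryGcd_eq_one_iff hn]
  refine forall_congr' fun d => forall_congr' fun hd => ?_
  rw [Nat.dvd_add_left (hd.mul_right t)]

theorem unitaryGcd_mul_left_eq_one_iff {n q : ℕ} (hn : 0 < n) (hq : q.Coprime n) (j : ℕ) :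
    unitaryGcd (q * j) n = 1 ↔ unitaryGcd j n = 1 := by
  rw [unitaryGcd_eq_one_iff hn, unitaryGcd_eq_one_iff hn]
  refine forall_congr' fun d => forall_congr' fun hd => ?_
  rw [(hq.symm.coprime_dvd_left hd).dvd_mul_left]

theorem unitaryGcd_prime_pow_mul_eq_one_iff {p k n : ℕ} (hp : p.Prime) (hk : 1 ≤ k)
    (hn : 0 < n) (hpn : ¬ p ∣ n) (j : ℕ) :
    unitaryGcd j (p ^ k * n) = 1 ↔ unitaryGcd j n = 1 ∧ ¬ p ^ k ∣ j := by
  have hcop : Nat.Coprime (p ^ k) n := ((hp.coprime_iff_not_dvd).2 hpn).pow_left k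
  have hq : 0 < p ^ k := pow_pos hp.pos k
  rw [unitaryGcd_eq_one_iff (by positivity), unitaryGcd_eq_one_iff hn]
  constructor
  · refine fun h => ⟨fun d hdn hd hdj => h d (hdn.mul_left _) ?_ hdj, fun hqj => ?_⟩
    · rw [Nat.mul_div_assoc _ hdn]
      exact (hcop.symm.coprime_dvd_left hdn).mul_right hd
    · have := h (p ^ k) (dvd_mul_right _ _) (by rwa [Nat.mul_div_cancel_left _ hq]) hqj
      exact (Nat.one_lt_pow (by omega) hp.one_lt).ne' this
  · rintro ⟨h, hqj⟩ d hdn hd hdj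
    by_cases hpd : p ∣ d
    · have hpe : Nat.Coprime (p ^ k) (p ^ k * n / d) := (hd.coprime_dvd_left hpd).pow_left k
      refine absurd (dvd_trans (hpe.dvd_of_dvd_mul_right ?_) hdj) hqj
      rw [Nat.mul_div_cancel' hdn]
      exact dvd_mul_right _ _
    · have hdq : Nat.Coprime d (p ^ k) := ((hp.coprime_iff_not_dvd).2 hpd).symm.pow_right k
      have hdn' : d ∣ n := hdq.dvd_of_dvd_mul_left hdn
      rw [Nat.mul_div_assoc _ hdn'] at hd
      exact h d hdn' hd.coprime_mul_left_right hdj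

theorem prod_Icc_one_mul {M : Type*} [CommMonoid M] (f : ℕ → M) (q n : ℕ) :
    ∏ i ∈ Icc 1 (q * n), f i = ∏ j ∈ Icc 1 n, ∏ t ∈ range q, f (j + n * t) := by
  have shift (m : ℕ) (g : ℕ → M) : ∏ i ∈ Icc 1 m, g i = ∏ i ∈ range m, g (i + 1) := by
    rw [Finset.range_eq_Ico, Finset.prod_Ico_add' g 0 m 1]
    rfl
  rw [Finset.prod_comm]
  simp only [shift]
  induction q with
  | zero => simp
  | succ q ih =>
    rw [Finset.prod_range_succ, ← ih, add_mul, one_mul, Finset.prod_range_add]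
    congr 1
    refine Finset.prod_congr rfl fun i _ => ?_
    congr 1
    ring

theorem X_pow_sub_C_exp_eq_prod {q n : ℕ} (hq : 0 < q) (hn : 0 < n) (j : ℕ) :
    (X ^ q - C (Complex.exp (2 * (Real.pi : ℂ) * Complex.I * (j : ℂ) / (n : ℂ))) : ℂ[X]) =
      ∏ t ∈ range q, (X - C (Complex.exp
        (2 * (Real.pi : ℂ) * Complex.I * ((j + n * t : ℕ) : ℂ) / ((q * n : ℕ) : ℂ)))) := by
  have hq' : (q : ℂ) ≠ 0 := by exact_mod_cast hq.ne'
  have hn' : (n : ℂ) ≠ 0 := by exact_mod_cast hn.ne'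
  rw [X_pow_sub_C_eq_prod (Complex.isPrimitiveRoot_exp q hq.ne') hq
    (α := Complex.exp (2 * (Real.pi : ℂ) * Complex.I * (j : ℂ) / ((q * n : ℕ) : ℂ)))]
  · refine Finset.prod_congr rfl fun t _ => ?_
    rw [← Complex.exp_nat_mul, ← Complex.exp_add]
    congr 3
    push_cast
    field_simp
    ring
  · rw [← Complex.exp_nat_mul]
    congr 1
    push_cast
    field_simp

/-- `Φ*_n(X^q)` has as roots the `q n`-th roots of unity with index `i` such that `(i, n)_* = 1`. -/
theorem unitaryCyclotomic_comp_X_pow {q n : ℕ} (hq : 0 < q) (hn : 0 < n) :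
    (unitaryCyclotomic n).comp (X ^ q) =
      ∏ i ∈ (Icc 1 (q * n)).filter fun i => unitaryGcd i n = 1,
        (X - C (Complex.exp (2 * (Real.pi : ℂ) * Complex.I * (i : ℂ) / ((q * n : ℕ) : ℂ)))) := by
  rw [unitaryCyclotomic, Polynomial.prod_comp, Finset.prod_filter, Finset.prod_filter,
    prod_Icc_one_mul]
  refine Finset.prod_congr rfl fun j _ => ?_
  simp only [unitaryGcd_add_mul_eq_one_iff hn]
  split_ifs
  · rw [sub_comp, X_comp, C_comp, X_pow_sub_C_exp_eq_prod hq hn]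
  · simp

/-- The roots of `Φ*_n`, written as `q n`-th roots of unity. -/
theorem unitaryCyclotomic_eq_prod_filter_dvd {q n : ℕ} (hq : 0 < q) (hn : 0 < n)
    (hqn : q.Coprime n) :
    unitaryCyclotomic n =
      ∏ i ∈ (Icc 1 (q * n)).filter fun i => unitaryGcd i n = 1 ∧ q ∣ i,
        (X - C (Complex.exp (2 * (Real.pi : ℂ) * Complex.I * (i : ℂ) / ((q * n : ℕ) : ℂ)))) := by
  have hq' : (q : ℂ) ≠ 0 := by exact_mod_cast hq.ne'
  have hn' : (n : ℂ) ≠ 0 := by exact_mod_cast hn.ne'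
  refine Finset.prod_bij (fun j _ => q * j) ?_ ?_ ?_ ?_
  · intro j hj
    simp only [Finset.mem_filter, Finset.mem_Icc] at hj ⊢
    refine ⟨⟨Nat.mul_pos hq hj.1.1, Nat.mul_le_mul_left q hj.1.2⟩,
      (unitaryGcd_mul_left_eq_one_iff hn hqn j).2 hj.2, dvd_mul_right q j⟩
  · intro i _ j _ h
    exact Nat.eq_of_mul_eq_mul_left hq h
  · intro i hi
    simp only [Finset.mem_filter, Finset.mem_Icc] at hi
    obtain ⟨⟨hi1, hi2⟩, hig, j, rfl⟩ := hi
    refine ⟨j, ?_, rfl⟩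
    simp only [Finset.mem_filter, Finset.mem_Icc]
    exact ⟨⟨Nat.pos_of_mul_pos_left hi1, Nat.le_of_mul_le_mul_left hi2 hq⟩,
      (unitaryGcd_mul_left_eq_one_iff hn hqn j).1 hig⟩
  · intro j _
    congr 3
    push_cast
    field_simp

/-- for `p` prime, `k ≥ 1`, `p ∤ n`:
`Φ*_{p^k n}(x) · Φ*_n(x) = Φ*_n(x^{p^k})`. -/
theorem unitaryCyclotomic_prime_pow_mul (p k n : ℕ) (hp : p.Prime) (hk : 1 ≤ k)
    (hn : 0 < n) (hpn : ¬ p ∣ n) :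
    unitaryCyclotomic (p ^ k * n) * unitaryCyclotomic n =
      (unitaryCyclotomic n).comp (X ^ p ^ k) := by
  have hqn : Nat.Coprime (p ^ k) n := ((hp.coprime_iff_not_dvd).2 hpn).pow_left k
  have hq : 0 < p ^ k := pow_pos hp.pos k
  rw [unitaryCyclotomic_comp_X_pow hq hn,
    ← Finset.prod_filter_mul_prod_filter_not _ (fun i => p ^ k ∣ i), Finset.filter_filter,
    Finset.filter_filter, ← unitaryCyclotomic_eq_prod_filter_dvd hq hn hqn, mul_comm,
    unitaryCyclotomic.eq_def (p ^ k * n)]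
  simp only [unitaryGcd_prime_pow_mul_eq_one_iff hp hk hn hpn]
end

section
/- For every positive integer n and every real number x > 1, one has Φ*_n(x) = ∏_{j=1}^{n} (x^{(j,n)_*} − 1)^{cos(2πj/n)}, where the exponents are real numbers; equivalently, log Φ*_n(x) = ∑_{j=1}^{n} cos(2πj/n) · log(x^{(j,n)_*} − 1). -/
open Polynomial Finset

theorem mem_unitaryDivisors {d n : ℕ} :
    d ∈ unitaryDivisors n ↔ ∃ c, n = d * c ∧ n ≠ 0 ∧ Nat.Coprime d c := by
  simp only [unitaryDivisors, mem_filter, Nat.mem_divisors]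
  constructor
  · rintro ⟨⟨⟨c, rfl⟩, h0⟩, h⟩
    have hd : 0 < d := Nat.pos_of_ne_zero (left_ne_zero_of_mul h0)
    exact ⟨c, rfl, h0, by rwa [Nat.mul_div_cancel_left _ hd] at h⟩
  · rintro ⟨c, rfl, h0, h⟩
    have hd : 0 < d := Nat.pos_of_ne_zero (left_ne_zero_of_mul h0)
    exact ⟨⟨dvd_mul_right _ _, h0⟩, by rwa [Nat.mul_div_cancel_left _ hd]⟩

theorem one_mem_unitaryDivisors {n : ℕ} (hn : 0 < n) : 1 ∈ unitaryDivisors n :=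
  mem_unitaryDivisors.2 ⟨n, by simp, hn.ne', by simp⟩

theorem self_mem_unitaryDivisors {n : ℕ} (hn : 0 < n) : n ∈ unitaryDivisors n :=
  mem_unitaryDivisors.2 ⟨1, by simp, hn.ne', by simp⟩

theorem pos_of_mem_unitaryDivisors {d n : ℕ} (h : d ∈ unitaryDivisors n) : 0 < d := by
  obtain ⟨c, rfl, h0, -⟩ := mem_unitaryDivisors.1 h
  exact Nat.pos_of_ne_zero (left_ne_zero_of_mul h0)

theorem dvd_of_mem_unitaryDivisors {d n : ℕ} (h : d ∈ unitaryDivisors n) : d ∣ n := by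
  obtain ⟨c, rfl, -, -⟩ := mem_unitaryDivisors.1 h
  exact dvd_mul_right _ _

theorem div_mem_unitaryDivisors {d n : ℕ} (h : d ∈ unitaryDivisors n) :
    n / d ∈ unitaryDivisors n := by
  have hd := pos_of_mem_unitaryDivisors h
  obtain ⟨c, rfl, h0, hc⟩ := mem_unitaryDivisors.1 h
  rw [Nat.mul_div_cancel_left _ hd]
  exact mem_unitaryDivisors.2 ⟨d, mul_comm _ _, h0, hc.symm⟩

theorem lcm_mem_unitaryDivisors {d e n : ℕ} (hd : d ∈ unitaryDivisors n)
    (he : e ∈ unitaryDivisors n) : Nat.lcm d e ∈ unitaryDivisors n := by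
  obtain ⟨c, hc⟩ := Nat.lcm_dvd (dvd_of_mem_unitaryDivisors hd) (dvd_of_mem_unitaryDivisors he)
  have hd0 := pos_of_mem_unitaryDivisors hd
  have he0 := pos_of_mem_unitaryDivisors he
  obtain ⟨a, ha, h0, had⟩ := mem_unitaryDivisors.1 hd
  obtain ⟨b, hb, -, hbe⟩ := mem_unitaryDivisors.1 he
  refine mem_unitaryDivisors.2 ⟨c, hc, h0, ?_⟩
  have hca : c ∣ a := by
    obtain ⟨u, hu⟩ := Nat.dvd_lcm_left d e
    refine ⟨u, Nat.eq_of_mul_eq_mul_left hd0 ?_⟩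
    rw [← ha, hc, hu]; ring
  have hcb : c ∣ b := by
    obtain ⟨u, hu⟩ := Nat.dvd_lcm_right d e
    refine ⟨u, Nat.eq_of_mul_eq_mul_left he0 ?_⟩
    rw [← hb, hc, hu]; ring
  exact Nat.Coprime.coprime_dvd_left (Nat.lcm_dvd_mul d e)
    (Nat.Coprime.mul_left (had.coprime_dvd_right hca) (hbe.coprime_dvd_right hcb))

theorem unitaryGcd_mem {n : ℕ} (hn : 0 < n) (j : ℕ) :
    unitaryGcd j n ∈ unitaryDivisors n ∧ unitaryGcd j n ∣ j := by
  have hne : ((unitaryDivisors n).filter fun d => d ∣ j).Nonempty :=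
    ⟨1, mem_filter.2 ⟨one_mem_unitaryDivisors hn, one_dvd _⟩⟩
  obtain ⟨d, hd, h⟩ := exists_mem_eq_sup _ hne (id : ℕ → ℕ)
  rw [unitaryGcd, h]
  exact mem_filter.1 hd

theorem dvd_unitaryGcd {e j n : ℕ} (he : e ∈ unitaryDivisors n) (hej : e ∣ j) :
    e ∣ unitaryGcd j n := by
  have hn : 0 < n := by
    obtain ⟨-, -, h0, -⟩ := mem_unitaryDivisors.1 he
    exact Nat.pos_of_ne_zero h0
  obtain ⟨hg, hgj⟩ := unitaryGcd_mem hn j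
  have hl : Nat.lcm (unitaryGcd j n) e ≤ unitaryGcd j n :=
    le_sup (f := id) (mem_filter.2 ⟨lcm_mem_unitaryDivisors hg he, Nat.lcm_dvd hgj hej⟩)
  have := Nat.le_antisymm hl
    (Nat.le_of_dvd (pos_of_mem_unitaryDivisors (lcm_mem_unitaryDivisors hg he))
      (Nat.dvd_lcm_left _ _))
  exact this ▸ Nat.dvd_lcm_right _ _

/-- The unitary divisors of `(j, n)_*` are the unitary divisors of `n` that divide `j`. -/
theorem unitaryDivisors_unitaryGcd {n : ℕ} (hn : 0 < n) (j : ℕ) :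
    unitaryDivisors (unitaryGcd j n) = (unitaryDivisors n).filter fun d => d ∣ j := by
  obtain ⟨hg, hgj⟩ := unitaryGcd_mem hn j
  have hg0 := (pos_of_mem_unitaryDivisors hg).ne'
  obtain ⟨b, hb, h0, hgb⟩ := mem_unitaryDivisors.1 hg
  ext e
  rw [mem_filter]
  constructor
  · intro he
    refine ⟨?_, (dvd_of_mem_unitaryDivisors he).trans hgj⟩
    obtain ⟨a, ha, -, hea⟩ := mem_unitaryDivisors.1 he
    refine mem_unitaryDivisors.2 ⟨a * b, by rw [← mul_assoc, ← ha, ← hb], h0, ?_⟩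
    exact hea.mul_right (hgb.coprime_dvd_left (dvd_of_mem_unitaryDivisors he))
  · rintro ⟨he, hej⟩
    obtain ⟨a, ha⟩ := dvd_unitaryGcd he hej
    have he0 := pos_of_mem_unitaryDivisors he
    obtain ⟨c, hc, -, hec⟩ := mem_unitaryDivisors.1 he
    refine mem_unitaryDivisors.2 ⟨a, ha, hg0, hec.coprime_dvd_right ⟨b, ?_⟩⟩
    refine Nat.eq_of_mul_eq_mul_left he0 ?_
    rw [← hc, ← mul_assoc, ← ha, ← hb]

theorem unitaryGcd_mul_left_eq_iff {d c : ℕ} (h0 : d * c ≠ 0) (hdc : Nat.Coprime d c) (k : ℕ) :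
    unitaryGcd (d * k) (d * c) = d ↔ unitaryGcd k c = 1 := by
  have hd : 0 < d := Nat.pos_of_ne_zero (left_ne_zero_of_mul h0)
  have hc : 0 < c := Nat.pos_of_ne_zero (right_ne_zero_of_mul h0)
  constructor
  · intro h
    obtain ⟨hg, hgk⟩ := unitaryGcd_mem hc k
    obtain ⟨a, ha, -, hga⟩ := mem_unitaryDivisors.1 hg
    generalize unitaryGcd k c = e at *
    have hm : d * e ∈ unitaryDivisors (d * c) :=
      mem_unitaryDivisors.2 ⟨a, by rw [ha, mul_assoc], h0,
        Nat.Coprime.mul_left (hdc.coprime_dvd_right ⟨e, by rw [ha, mul_comm]⟩) hga⟩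
    have := dvd_unitaryGcd hm (mul_dvd_mul_left d hgk)
    rw [h] at this
    exact Nat.dvd_one.1 (Nat.dvd_of_mul_dvd_mul_left hd (by simpa using this))
  · intro h
    obtain ⟨hg, hgk⟩ := unitaryGcd_mem (Nat.pos_of_ne_zero h0) (d * k)
    obtain ⟨e, he⟩ := dvd_unitaryGcd (mem_unitaryDivisors.2 ⟨c, rfl, h0, hdc⟩) (dvd_mul_right d k)
    rw [he] at hg hgk ⊢
    obtain ⟨a, ha, -, hga⟩ := mem_unitaryDivisors.1 hg
    have hca : c = e * a := Nat.eq_of_mul_eq_mul_left hd (by rw [ha, mul_assoc])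
    have hek : e ∣ k := Nat.dvd_of_mul_dvd_mul_left hd hgk
    have := dvd_unitaryGcd
      (mem_unitaryDivisors.2 ⟨a, hca, hc.ne', hga.coprime_dvd_left (dvd_mul_left e d)⟩) hek
    rw [h, Nat.dvd_one] at this
    rw [this, mul_one]

/-- Reindexing the multiples of `d` in `{1, …, d c}`. -/
theorem prod_filter_dvd_Icc {M : Type*} [CommMonoid M] {d : ℕ} (hd : 0 < d) (c : ℕ) (f : ℕ → M) :
    ∏ j ∈ (Icc 1 (d * c)).filter (fun j => d ∣ j), f j = ∏ k ∈ Icc 1 c, f (d * k) := by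
  have : (Icc 1 (d * c)).filter (fun j => d ∣ j) = (Icc 1 c).image (d * ·) := by
    ext j
    simp only [mem_filter, mem_Icc, mem_image]
    constructor
    · rintro ⟨⟨h1, h2⟩, k, rfl⟩
      exact ⟨k, ⟨Nat.pos_of_ne_zero (by rintro rfl; simp at h1),
        Nat.le_of_mul_le_mul_left h2 hd⟩, rfl⟩
    · rintro ⟨k, ⟨h1, h2⟩, rfl⟩
      exact ⟨⟨Nat.mul_pos hd h1, Nat.mul_le_mul_left d h2⟩, dvd_mul_right _ _⟩
  rw [this, prod_image fun a _ b _ h => Nat.eq_of_mul_eq_mul_left hd h]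

theorem exp_mul_div_mul_left {d : ℕ} (hd : 0 < d) (k c : ℕ) :
    Complex.exp (2 * (Real.pi : ℂ) * Complex.I * ((d * k : ℕ) : ℂ) / ((d * c : ℕ) : ℂ)) =
      Complex.exp (2 * (Real.pi : ℂ) * Complex.I * (k : ℂ) / (c : ℂ)) := by
  have : (d : ℂ) ≠ 0 := by exact_mod_cast hd.ne'
  congr 1
  push_cast
  rw [mul_left_comm, mul_div_mul_left _ _ this]

theorem exp_eq_pow (k c : ℕ) :
    Complex.exp (2 * (Real.pi : ℂ) * Complex.I * (k : ℂ) / (c : ℂ)) =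
      Complex.exp (2 * (Real.pi : ℂ) * Complex.I / (c : ℂ)) ^ k := by
  rw [← Complex.exp_nat_mul]
  congr 1
  ring

@[to_additive]
theorem prod_Icc_eq_prod_range {M : Type*} [CommMonoid M] {n : ℕ} (hn : 0 < n) (f : ℕ → M)
    (h : f n = f 0) : ∏ k ∈ Icc 1 n, f k = ∏ k ∈ range n, f k := by
  have hshift (m : ℕ) : ∏ k ∈ Icc 1 m, f k = ∏ k ∈ range m, f (k + 1) := by
    induction m with
    | zero => simp
    | succ m ih => rw [prod_Icc_succ_top (by omega), prod_range_succ, ih]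
  obtain ⟨m, rfl⟩ := Nat.exists_eq_succ_of_ne_zero hn.ne'
  rw [hshift, prod_range_succ, h, prod_range_succ']

theorem X_pow_sub_one_eq_prod_exp {n : ℕ} (hn : 0 < n) :
    (X ^ n - 1 : ℂ[X]) =
      ∏ j ∈ Icc 1 n, (X - C (Complex.exp (2 * (Real.pi : ℂ) * Complex.I * (j : ℂ) / (n : ℂ)))) := by
  have hz := Complex.isPrimitiveRoot_exp n hn.ne'
  simp only [exp_eq_pow]
  rw [prod_Icc_eq_prod_range hn _ (by rw [hz.pow_eq_one, pow_zero]),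
    X_pow_sub_one_eq_prod hn hz]
  have hset : nthRootsFinset n (1 : ℂ) =
      (range n).image (Complex.exp (2 * (Real.pi : ℂ) * Complex.I / (n : ℂ)) ^ ·) := by
    ext z
    rw [mem_nthRootsFinset hn, mem_image]
    constructor
    · intro h
      have : NeZero n := ⟨hn.ne'⟩
      obtain ⟨i, hi, hi'⟩ := hz.eq_pow_of_pow_eq_one h
      exact ⟨i, mem_range.2 hi, hi'⟩
    · rintro ⟨i, -, rfl⟩
      rw [pow_right_comm, hz.pow_eq_one, one_pow]
  rw [hset, prod_image fun a ha b hb h => hz.pow_inj (mem_range.1 ha) (mem_range.1 hb) h]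

/-- `x ^ n - 1` is the product of the `Φ*_d` over the unitary divisors `d` of `n`. -/
theorem prod_unitaryCyclotomic {n : ℕ} (hn : 0 < n) :
    ∏ d ∈ unitaryDivisors n, unitaryCyclotomic d = X ^ n - 1 := by
  rw [X_pow_sub_one_eq_prod_exp hn,
    ← prod_fiberwise_of_maps_to (s := Icc 1 n) (t := unitaryDivisors n)
      (g := fun j => unitaryGcd j n)
      (fun j _ => (unitaryGcd_mem hn j).1)]
  refine prod_bij' (fun d _ => n / d) (fun d _ => n / d)
    (fun d => div_mem_unitaryDivisors) (fun d => div_mem_unitaryDivisors) ?_ ?_ ?_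
  · exact fun d hd => Nat.div_div_self (dvd_of_mem_unitaryDivisors hd) hn.ne'
  · exact fun d hd => Nat.div_div_self (dvd_of_mem_unitaryDivisors hd) hn.ne'
  · intro c hc
    have hc0 := pos_of_mem_unitaryDivisors hc
    obtain ⟨d, rfl, h0, hcd⟩ := mem_unitaryDivisors.1 hc
    have hd0 : 0 < d := Nat.pos_of_ne_zero (right_ne_zero_of_mul h0)
    rw [Nat.mul_div_cancel_left _ hc0, mul_comm c d] at *
    have hf : (Icc 1 (d * c)).filter (fun j => unitaryGcd j (d * c) = d) =
        ((Icc 1 (d * c)).filter (fun j => d ∣ j)).filter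
          (fun j => unitaryGcd j (d * c) = d) := by
      rw [filter_filter]
      refine filter_congr fun j _ => ⟨fun h => ⟨?_, h⟩, fun h => h.2⟩
      exact h ▸ (unitaryGcd_mem hn j).2
    rw [hf, prod_filter, prod_filter_dvd_Icc hd0, unitaryCyclotomic, prod_filter]
    refine prod_congr rfl fun k _ => ?_
    simp only [unitaryGcd_mul_left_eq_iff h0 hcd.symm, exp_mul_div_mul_left hd0]

/-- For real `x > 1`, the value `Φ*_n(x)` is a positive real number. -/
theorem exists_eval_unitaryCyclotomic_eq_ofReal {x : ℝ} (hx : 1 < x) (n : ℕ) (hn : 0 < n) :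
    ∃ r : ℝ, 0 < r ∧ (unitaryCyclotomic n).eval (x : ℂ) = r := by
  induction n using Nat.strong_induction_on with
  | _ n ih =>
    have hx' : 0 < x ^ n - 1 := sub_pos.2 (one_lt_pow₀ hx hn.ne')
    have hprod : ∃ s : ℝ, 0 < s ∧
        ∏ d ∈ (unitaryDivisors n).erase n, (unitaryCyclotomic d).eval (x : ℂ) = s := by
      refine prod_induction _ (fun z : ℂ => ∃ s : ℝ, 0 < s ∧ z = s) ?_ ⟨1, one_pos, by simp⟩ ?_
      · rintro _ _ ⟨a, ha, rfl⟩ ⟨b, hb, rfl⟩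
        exact ⟨a * b, mul_pos ha hb, by push_cast; rfl⟩
      · intro d hd
        obtain ⟨hdn, hd⟩ := mem_erase.1 hd
        exact ih d (lt_of_le_of_ne (Nat.le_of_dvd hn (dvd_of_mem_unitaryDivisors hd)) hdn)
          (pos_of_mem_unitaryDivisors hd)
    obtain ⟨s, hs, hs'⟩ := hprod
    have h := congrArg (Polynomial.eval (x : ℂ)) (prod_unitaryCyclotomic hn)
    rw [← mul_prod_erase _ _ (self_mem_unitaryDivisors hn), eval_mul, eval_prod, hs'] at h
    refine ⟨(x ^ n - 1) / s, div_pos hx' hs, ?_⟩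
    have hs0 : (s : ℂ) ≠ 0 := by exact_mod_cast hs.ne'
    push_cast
    rw [eq_div_iff hs0, h]
    simp

theorem sum_cos_two_pi_mul_div {n : ℕ} (hn : 0 < n) :
    ∑ k ∈ Icc 1 n, Real.cos (2 * Real.pi * k / n) = if n = 1 then 1 else 0 := by
  split_ifs with h
  · subst h
    simp
  · have hz := (Complex.isPrimitiveRoot_exp n hn.ne').geom_sum_eq_zero (by omega)
    have h0 : ∑ k ∈ Icc 1 n,
        Complex.exp (2 * (Real.pi : ℂ) * Complex.I * (k : ℂ) / (n : ℂ)) = 0 := by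
      simp only [exp_eq_pow]
      rw [sum_Icc_eq_sum_range hn _ (by
        rw [(Complex.isPrimitiveRoot_exp n hn.ne').pow_eq_one, pow_zero]), hz]
    have := congrArg Complex.re h0
    rw [Complex.re_sum, Complex.zero_re] at this
    rw [← this]
    refine sum_congr rfl fun k _ => ?_
    rw [← Complex.exp_ofReal_mul_I_re]
    congr 2
    push_cast
    ring

/-- Schramm-type identity for `x > 1`:
`Φ*_n(x) = ∏_{j=1}^n (x^{(j,n)_*} - 1)^{cos (2πj/n)}` (real powers). -/
theorem unitaryCyclotomic_schramm (n : ℕ) (hn : 0 < n) (x : ℝ) (hx : 1 < x) :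
    Polynomial.eval (x : ℂ) (unitaryCyclotomic n) =
      (((∏ j ∈ Finset.Icc 1 n,
          (x ^ unitaryGcd j n - 1) ^ Real.cos (2 * Real.pi * j / n)) : ℝ) : ℂ) := by
  choose! r hr_pos hr using exists_eval_unitaryCyclotomic_eq_ofReal hx
  have hprod (m : ℕ) (hm : 0 < m) : x ^ m - 1 = ∏ d ∈ unitaryDivisors m, r d := by
    have h := congrArg (Polynomial.eval (x : ℂ)) (prod_unitaryCyclotomic hm)
    rw [eval_prod, prod_congr rfl fun d hd => hr d (pos_of_mem_unitaryDivisors hd)] at h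
    simp only [eval_sub, eval_pow, eval_X, eval_one] at h
    exact_mod_cast h.symm
  rw [hr n hn, Complex.ofReal_inj]
  symm
  calc ∏ j ∈ Icc 1 n, (x ^ unitaryGcd j n - 1) ^ Real.cos (2 * Real.pi * j / n)
      = ∏ j ∈ Icc 1 n, ∏ d ∈ unitaryDivisors n,
          if d ∣ j then r d ^ Real.cos (2 * Real.pi * j / n) else 1 := by
        refine prod_congr rfl fun j _ => ?_
        rw [hprod _ (pos_of_mem_unitaryDivisors (unitaryGcd_mem hn j).1),
          unitaryDivisors_unitaryGcd hn, ← Real.finsetProd_rpow, prod_filter]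
        exact fun d hd => (hr_pos d (pos_of_mem_unitaryDivisors (mem_filter.1 hd).1)).le
    _ = ∏ d ∈ unitaryDivisors n, if d = n then r d else 1 := by
        rw [prod_comm]
        refine prod_congr rfl fun d hd => ?_
        have hd0 := pos_of_mem_unitaryDivisors hd
        obtain ⟨c, rfl, h0, -⟩ := mem_unitaryDivisors.1 hd
        have hc0 : 0 < c := Nat.pos_of_ne_zero (right_ne_zero_of_mul h0)
        have hd' : (d : ℝ) ≠ 0 := by exact_mod_cast hd0.ne'
        rw [← prod_filter, prod_filter_dvd_Icc hd0, ← Real.rpow_sum_of_pos (hr_pos d hd0)]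
        have hcos (k : ℕ) : 2 * Real.pi * ((d * k : ℕ) : ℝ) / ((d * c : ℕ) : ℝ) =
            2 * Real.pi * k / c := by
          push_cast
          rw [mul_left_comm, mul_div_mul_left _ _ hd']
        simp only [hcos, sum_cos_two_pi_mul_div hc0]
        have : c = 1 ↔ d = d * c := by simp [hd0.ne']
        simp only [← this]
        split_ifs <;> simp
    _ = r n := by rw [prod_ite_eq', if_pos (self_mem_unitaryDivisors hn)]
end
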